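/- arXiv:1810.00963 — 3 statements merged into one kernel-verified Lean document; each statement's English description precedes it below -/
import Mathlib

section
/- Let 1 ≤ p < q < ∞ and d ≥ 1. Then the James constant of the Morrey space M^p_q(ℝ^d) equals 2; that is, sup{ min{‖f+g‖_{M^p_q}, ‖f−g‖_{M^p_q}} : f, g ∈ M^p_q(ℝ^d), ‖f‖_{M^p_q} = ‖g‖_{M^p_q} = 1 } = 2. -/
open MeasureTheory
open scoped ENNReal

/-- The Morrey norm `‖f‖_{M^p_q}` of a (measurable) function on `ℝ^d`:
the supremum over all balls `B = B(a,r)` of `|B|^(1/q - 1/p) (∫_B |f|^p)^(1/p)`. -/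
noncomputable def morreyNorm (p q : ℝ) (d : ℕ) (f : EuclideanSpace ℝ (Fin d) → ℝ) : ℝ≥0∞ :=
  ⨆ (a : EuclideanSpace ℝ (Fin d)) (r : ℝ) (_ : 0 < r),
    volume (Metric.ball a r) ^ ((1:ℝ)/q - 1/p) *
      (∫⁻ y in Metric.ball a r, ENNReal.ofReal (|f y| ^ p)) ^ ((1:ℝ)/p)

lemma ofReal_abs_rpow_eq_enorm_rpow {p : ℝ} (hp : 0 ≤ p) (x : ℝ) :
    ENNReal.ofReal (|x| ^ p) = ‖x‖ₑ ^ p := by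
  rw [← ENNReal.ofReal_rpow_of_nonneg (abs_nonneg x) hp, ← Real.enorm_eq_ofReal_abs]

/-- The triangle inequality for the Morrey norm. -/
lemma morreyNorm_add_le {p q : ℝ} {d : ℕ} (hp : 1 ≤ p) {f g : EuclideanSpace ℝ (Fin d) → ℝ}
    (hf : Measurable f) (hg : Measurable g) :
    morreyNorm p q d (f + g) ≤ morreyNorm p q d f + morreyNorm p q d g := by
  have hp0 : 0 ≤ p := by linarith
  refine iSup_le fun a => iSup_le fun r => iSup_le fun hr => ?_
  have hle : ∀ h : EuclideanSpace ℝ (Fin d) → ℝ,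
      volume (Metric.ball a r) ^ ((1:ℝ)/q - 1/p) *
        (∫⁻ y in Metric.ball a r, ENNReal.ofReal (|h y| ^ p)) ^ ((1:ℝ)/p) ≤
        morreyNorm p q d h := fun h => by
    unfold morreyNorm
    exact le_iSup_of_le a (le_iSup_of_le r (le_iSup_of_le hr le_rfl))
  refine le_trans ?_ (add_le_add (hle f) (hle g))
  rw [← mul_add]
  gcongr
  simp only [ofReal_abs_rpow_eq_enorm_rpow hp0]
  refine le_trans ?_ (ENNReal.lintegral_Lp_add_le (p := p) (f := fun y => ‖f y‖ₑ)
    (g := fun y => ‖g y‖ₑ) hf.enorm.aemeasurable hg.enorm.aemeasurable hp)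
  gcongr with y
  exact enorm_add_le _ _

/-- The Morrey norm of a function of constant modulus on a measurable set, zero elsewhere. -/
lemma morreyNorm_of_abs_eq_indicator {p : ℝ} (q : ℝ) {d : ℕ} (hp : 0 < p)
    {S : Set (EuclideanSpace ℝ (Fin d))} (hS : MeasurableSet S) {c : ℝ} (hc : 0 ≤ c)
    {f : EuclideanSpace ℝ (Fin d) → ℝ} (hf : ∀ y, |f y| = S.indicator (fun _ => c) y) :
    morreyNorm p q d f = ENNReal.ofReal c *
      ⨆ (a : EuclideanSpace ℝ (Fin d)) (r : ℝ) (_ : 0 < r),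
        volume (Metric.ball a r) ^ ((1:ℝ)/q - 1/p) *
          volume (S ∩ Metric.ball a r) ^ ((1:ℝ)/p) := by
  unfold morreyNorm
  simp only [ENNReal.mul_iSup]
  refine iSup_congr fun a => iSup_congr fun r => iSup_congr fun hr => ?_
  have hind : ∀ y, ENNReal.ofReal (|f y| ^ p) =
      S.indicator (fun _ => ENNReal.ofReal c ^ p) y := fun y => by
    rw [hf y]
    by_cases hy : y ∈ S
    · simp [hy, ENNReal.ofReal_rpow_of_nonneg hc hp.le]
    · simp [hy, Real.zero_rpow hp.ne']
  simp only [hind]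
  rw [lintegral_indicator_const hS, Measure.restrict_apply hS,
    ENNReal.mul_rpow_of_nonneg _ _ (by positivity), ← ENNReal.rpow_mul,
    mul_one_div_cancel hp.ne', ENNReal.rpow_one]
  ring

/-- If `S` contains a unit ball, meets small balls in at most the measure of a unit ball, and
meets large balls in at most twice that measure, then its Morrey supremum is the one of a unit
ball. -/
lemma iSup_volume_rpow_mul_eq {p q : ℝ} {d : ℕ} (hp : 0 < p) (hpq : p < q) (hd : 1 ≤ d)
    {S : Set (EuclideanSpace ℝ (Fin d))} {b : EuclideanSpace ℝ (Fin d)}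
    (hb : Metric.ball b 1 ⊆ S) {K : ℝ} (hK : 1 ≤ K)
    (hK2 : ENNReal.ofReal K ^ ((1:ℝ)/q - 1/p) * 2 ^ ((1:ℝ)/p) ≤ 1)
    (hS : ∀ a r, 0 < r →
      volume (S ∩ Metric.ball a r) ≤ volume (Metric.ball (0 : EuclideanSpace ℝ (Fin d)) 1) ∨
      volume (S ∩ Metric.ball a r) ≤ 2 * volume (Metric.ball (0 : EuclideanSpace ℝ (Fin d)) 1) ∧
        K ≤ r) :
    (⨆ (a : EuclideanSpace ℝ (Fin d)) (r : ℝ) (_ : 0 < r),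
        volume (Metric.ball a r) ^ ((1:ℝ)/q - 1/p) *
          volume (S ∩ Metric.ball a r) ^ ((1:ℝ)/p)) =
      volume (Metric.ball (0 : EuclideanSpace ℝ (Fin d)) 1) ^ ((1:ℝ)/q) := by
  set w := volume (Metric.ball (0 : EuclideanSpace ℝ (Fin d)) 1) with hw
  have hq : 0 < q := hp.trans hpq
  have hw0 : w ≠ 0 := (Metric.measure_ball_pos volume _ one_pos).ne'
  have hwt : w ≠ ⊤ := measure_ball_lt_top.ne
  have he : (1:ℝ)/q - 1/p ≤ 0 := by
    rw [sub_nonpos]; exact one_div_le_one_div_of_le hp hpq.le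
  have hsplit : ∀ m : ℝ≥0∞, m ≠ 0 → m ≠ ⊤ →
      m ^ ((1:ℝ)/q - 1/p) * m ^ ((1:ℝ)/p) = m ^ ((1:ℝ)/q) := fun m h0 ht => by
    rw [← ENNReal.rpow_add _ _ h0 ht, sub_add_cancel]
  have hanti : ∀ {m n : ℝ≥0∞}, m ≤ n → n ^ ((1:ℝ)/q - 1/p) ≤ m ^ ((1:ℝ)/q - 1/p) :=
    fun {m n} h => by
      rw [← neg_neg ((1:ℝ)/q - 1/p), ENNReal.rpow_neg n, ENNReal.rpow_neg m, ENNReal.inv_le_inv]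
      exact ENNReal.rpow_le_rpow h (neg_nonneg.2 he)
  refine le_antisymm (iSup_le fun a => iSup_le fun r => iSup_le fun hr => ?_) ?_
  · have hm0 : volume (Metric.ball a r) ≠ 0 := (Metric.measure_ball_pos volume _ hr).ne'
    have hmt : volume (Metric.ball a r) ≠ ⊤ := measure_ball_lt_top.ne
    rcases hS a r hr with h | ⟨h, hKr⟩
    · rcases le_total (volume (Metric.ball a r)) w with hmw | hmw
      · calc _ ≤ volume (Metric.ball a r) ^ ((1:ℝ)/q - 1/p) *
              volume (Metric.ball a r) ^ ((1:ℝ)/p) := by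
              gcongr; exact Set.inter_subset_right
          _ = volume (Metric.ball a r) ^ ((1:ℝ)/q) := hsplit _ hm0 hmt
          _ ≤ _ := by gcongr
      · calc _ ≤ w ^ ((1:ℝ)/q - 1/p) * w ^ ((1:ℝ)/p) := by
              gcongr ?_ * ?_ ^ _
              exact hanti hmw
          _ = _ := hsplit _ hw0 hwt
    · have hm : ENNReal.ofReal K * w ≤ volume (Metric.ball a r) := by
        rw [Measure.addHaar_ball_of_pos volume a hr, finrank_euclideanSpace_fin]
        gcongr
        exact hKr.trans (le_self_pow₀ (hK.trans hKr) (by omega))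
      calc _ ≤ (ENNReal.ofReal K * w) ^ ((1:ℝ)/q - 1/p) * (2 * w) ^ ((1:ℝ)/p) := by
            gcongr ?_ * ?_ ^ _
            exact hanti hm
        _ = (ENNReal.ofReal K ^ ((1:ℝ)/q - 1/p) * 2 ^ ((1:ℝ)/p)) *
              (w ^ ((1:ℝ)/q - 1/p) * w ^ ((1:ℝ)/p)) := by
            rw [ENNReal.mul_rpow_of_ne_top ENNReal.ofReal_ne_top hwt,
              ENNReal.mul_rpow_of_nonneg _ _ (by positivity)]
            ring
        _ ≤ 1 * w ^ ((1:ℝ)/q) := by rw [hsplit _ hw0 hwt]; gcongr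
        _ = _ := one_mul _
  · refine le_iSup_of_le b (le_iSup_of_le 1 (le_iSup_of_le one_pos ?_))
    rw [Set.inter_eq_self_of_subset_right hb, Measure.addHaar_ball_center, ← hw,
      hsplit _ hw0 hwt]

/-- There are functions in the unit sphere of the Morrey space at which the James constant
is attained. -/
lemma exists_morreyNorm_add_eq_two {p q : ℝ} {d : ℕ} (hp : 0 < p) (hpq : p < q) (hd : 1 ≤ d) :
    ∃ f g : EuclideanSpace ℝ (Fin d) → ℝ, Measurable f ∧ Measurable g ∧
      morreyNorm p q d f = 1 ∧ morreyNorm p q d g = 1 ∧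
      morreyNorm p q d (f + g) = 2 ∧ morreyNorm p q d (f - g) = 2 := by
  have hq : 0 < q := hp.trans hpq
  have hpq' : 0 < (1:ℝ)/p - 1/q := sub_pos.2 (one_div_lt_one_div_of_lt hp hpq)
  obtain ⟨K, hK, hK2⟩ : ∃ K : ℝ, 1 ≤ K ∧
      ENNReal.ofReal K ^ ((1:ℝ)/q - 1/p) * 2 ^ ((1:ℝ)/p) ≤ 1 := by
    refine ⟨2 ^ ((1/p) / ((1:ℝ)/p - 1/q)),
      Real.one_le_rpow one_le_two (by positivity), ?_⟩
    rw [← ENNReal.ofReal_rpow_of_pos two_pos, ← ENNReal.rpow_mul,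
      show (1/p) / ((1:ℝ)/p - 1/q) * (1/q - 1/p) = -(1/p) by
        rw [← neg_sub (1/p) (1/q), mul_neg, div_mul_cancel₀ _ hpq'.ne'],
      show ENNReal.ofReal 2 = 2 by simp,
      ← ENNReal.rpow_add _ _ two_ne_zero ENNReal.ofNat_ne_top]
    simp
  set E := EuclideanSpace ℝ (Fin d)
  set b : E := EuclideanSpace.single ⟨0, hd⟩ (2 * K + 2) with hb
  have hbn : dist (0 : E) b = 2 * K + 2 := by
    rw [dist_zero_left, hb, PiLp.norm_single, Real.norm_of_nonneg (by linarith)]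
  set A : Set E := Metric.ball 0 1
  set B : Set E := Metric.ball b 1
  have hA : MeasurableSet A := measurableSet_ball
  have hB : MeasurableSet B := measurableSet_ball
  have hdisj : Disjoint A B := Metric.ball_disjoint_ball (by rw [hbn]; linarith)
  have hBA : volume B = volume A := Measure.addHaar_ball_center _ _ _
  set w := volume A
  have hw0 : w ≠ 0 := (Metric.measure_ball_pos volume _ one_pos).ne'
  have hwt : w ≠ ⊤ := measure_ball_lt_top.ne
  have hsup1 := iSup_volume_rpow_mul_eq hp hpq hd (S := A) (b := 0) subset_rfl hK hK2
    fun a r _ => Or.inl (measure_mono Set.inter_subset_left)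
  have hsup2 := iSup_volume_rpow_mul_eq hp hpq hd (S := B) (b := b) subset_rfl hK hK2
    fun a r _ => Or.inl ((measure_mono Set.inter_subset_left).trans hBA.le)
  have hsup3 := iSup_volume_rpow_mul_eq hp hpq hd (S := A ∪ B) (b := 0)
    Set.subset_union_left hK hK2 fun a r hr => by
      by_cases hKr : K ≤ r
      · refine Or.inr ⟨?_, hKr⟩
        calc _ ≤ volume (A ∪ B) := measure_mono Set.inter_subset_left
          _ ≤ volume A + volume B := measure_union_le _ _
          _ = 2 * w := by rw [hBA, two_mul]
      · left
        by_cases h0 : Disjoint A (Metric.ball a r)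
        · rw [Set.union_inter_distrib_right, h0.inter_eq, Set.empty_union]
          exact (measure_mono Set.inter_subset_left).trans hBA.le
        · have h1 : Disjoint B (Metric.ball a r) := by
            obtain ⟨x, hxA, hxa⟩ := Set.not_disjoint_iff.1 h0
            refine Set.disjoint_left.2 fun y hyB hya => ?_
            rw [Metric.mem_ball] at hxA hxa hyB hya
            have h1 := dist_triangle4 (0 : E) x y b
            have h2 := dist_triangle_right x y a
            rw [dist_comm] at hxA
            linarith
          rw [Set.union_inter_distrib_right, h1.inter_eq, Set.union_empty]
          exact measure_mono Set.inter_subset_left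
  set c : ℝ := (w ^ (-((1:ℝ)/q))).toReal
  have hc : ENNReal.ofReal c * w ^ ((1:ℝ)/q) = 1 := by
    rw [ENNReal.ofReal_toReal (ENNReal.rpow_ne_top_of_ne_zero hw0 hwt),
      ← ENNReal.rpow_add _ _ hw0 hwt]
    simp
  have hc0 : 0 ≤ c := ENNReal.toReal_nonneg
  have hc2 : ENNReal.ofReal (2 * c) * w ^ ((1:ℝ)/q) = 2 := by
    rw [ENNReal.ofReal_mul zero_le_two, mul_assoc, hc]; simp
  refine ⟨A.indicator (fun _ => c) + B.indicator (fun _ => c),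
    A.indicator (fun _ => c) - B.indicator (fun _ => c),
    (measurable_const.indicator hA).add (measurable_const.indicator hB),
    (measurable_const.indicator hA).sub (measurable_const.indicator hB), ?_, ?_, ?_, ?_⟩
  iterate 2
    · rw [morreyNorm_of_abs_eq_indicator q hp (hA.union hB) hc0, hsup3, hc]
      intro y
      by_cases hyA : y ∈ A
      · simp [hyA, Set.disjoint_left.1 hdisj hyA, abs_of_nonneg hc0]
      · by_cases hyB : y ∈ B <;> simp [hyA, hyB, abs_of_nonneg hc0]
  · rw [morreyNorm_of_abs_eq_indicator q hp hA (mul_nonneg zero_le_two hc0), hsup1, hc2]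
    intro y
    by_cases hyA : y ∈ A
    · simp [hyA, ← two_mul, abs_of_nonneg hc0]
    · simp [hyA]
  · rw [morreyNorm_of_abs_eq_indicator q hp hB (mul_nonneg zero_le_two hc0), hsup2, hc2]
    intro y
    by_cases hyB : y ∈ B
    · simp [hyB, ← two_mul, abs_of_nonneg hc0]
    · simp [hyB]

/-- The James constant of the Morrey space `M^p_q(ℝ^d)` equals `2`
when `1 ≤ p < q < ∞` and `d ≥ 1`. -/
theorem james_morrey (p q : ℝ) (d : ℕ) (hp : 1 ≤ p) (hpq : p < q) (hd : 1 ≤ d) :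
    (⨆ (f : EuclideanSpace ℝ (Fin d) → ℝ) (g : EuclideanSpace ℝ (Fin d) → ℝ)
      (_ : Measurable f) (_ : Measurable g)
      (_ : morreyNorm p q d f = 1) (_ : morreyNorm p q d g = 1),
      min (morreyNorm p q d (f + g)) (morreyNorm p q d (f - g))) = 2 := by
  apply le_antisymm
  · refine iSup_le fun f => iSup_le fun g => iSup_le fun hf => iSup_le fun hg =>
      iSup_le fun hf1 => iSup_le fun hg1 => (min_le_left _ _).trans ?_
    refine (morreyNorm_add_le hp hf hg).trans ?_
    rw [hf1, hg1, one_add_one_eq_two]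
  · obtain ⟨f, g, hf, hg, hf1, hg1, hadd, hsub⟩ :=
      exists_morreyNorm_add_eq_two (one_pos.trans_le hp) hpq hd
    refine le_iSup_of_le f <| le_iSup_of_le g <| le_iSup_of_le hf <| le_iSup_of_le hg <|
      le_iSup_of_le hf1 <| le_iSup_of_le hg1 ?_
    rw [hadd, hsub, min_self]
end

section
/- Let 1 ≤ p < q < ∞ and d ≥ 1. Then the James constant of the discrete Morrey space ℓ^p_q(ℤ^d) equals 2; that is, sup{ min{‖x+y‖_{ℓ^p_q}, ‖x−y‖_{ℓ^p_q}} : x, y ∈ ℓ^p_q(ℤ^d), ‖x‖_{ℓ^p_q} = ‖y‖_{ℓ^p_q} = 1 } = 2. -/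
open MeasureTheory
open scoped ENNReal

/-- The discrete Morrey norm `‖x‖_{ℓ^p_q}` of `x : ℤ^d → ℝ`:
the supremum over `m ∈ ℤ^d` and `N ∈ ℕ` of
`|S_{m,N}|^(1/q - 1/p) (∑_{k ∈ S_{m,N}} |x k|^p)^(1/p)`, where
`S_{m,N} = {k : ‖k - m‖_∞ ≤ N}` has cardinality `(2N+1)^d`. -/
noncomputable def discreteMorreyNorm (p q : ℝ) (d : ℕ) (x : (Fin d → ℤ) → ℝ) : ℝ≥0∞ :=
  ⨆ (m : Fin d → ℤ) (N : ℕ),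
    (((2 * N + 1) ^ d : ℕ) : ℝ≥0∞) ^ ((1:ℝ)/q - 1/p) *
      (∑ k ∈ Fintype.piFinset (fun i => Finset.Icc (m i - (N:ℤ)) (m i + (N:ℤ))),
        ENNReal.ofReal (|x k| ^ p)) ^ ((1:ℝ)/p)

theorem discreteMorreyNorm_add_le {p : ℝ} (hp : 1 ≤ p) (q : ℝ) (d : ℕ)
    (x y : (Fin d → ℤ) → ℝ) :
    discreteMorreyNorm p q d (x + y) ≤ discreteMorreyNorm p q d x + discreteMorreyNorm p q d y := by
  have hp0 : 0 ≤ p := zero_le_one.trans hp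
  refine iSup₂_le fun m N => ?_
  refine le_trans ?_ (add_le_add
    (le_iSup₂ (f := fun (m : Fin d → ℤ) (N : ℕ) =>
      (((2 * N + 1) ^ d : ℕ) : ℝ≥0∞) ^ ((1:ℝ)/q - 1/p) *
      (∑ k ∈ Fintype.piFinset (fun i => Finset.Icc (m i - (N:ℤ)) (m i + (N:ℤ))),
        ENNReal.ofReal (|x k| ^ p)) ^ ((1:ℝ)/p)) m N)
    (le_iSup₂ (f := fun (m : Fin d → ℤ) (N : ℕ) =>
      (((2 * N + 1) ^ d : ℕ) : ℝ≥0∞) ^ ((1:ℝ)/q - 1/p) *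
      (∑ k ∈ Fintype.piFinset (fun i => Finset.Icc (m i - (N:ℤ)) (m i + (N:ℤ))),
        ENNReal.ofReal (|y k| ^ p)) ^ ((1:ℝ)/p)) m N))
  rw [← mul_add]
  refine mul_le_mul_right ?_ _
  simp only [← ENNReal.ofReal_rpow_of_nonneg (abs_nonneg _) hp0]
  refine le_trans ?_ (ENNReal.Lp_add_le _ _ _ hp)
  gcongr with k
  rw [← ENNReal.ofReal_add (abs_nonneg _) (abs_nonneg _)]
  exact ENNReal.ofReal_le_ofReal (abs_add_le _ _)

theorem ofReal_abs_le_discreteMorreyNorm {p : ℝ} (hp : 0 < p) (q : ℝ) {d : ℕ}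
    (x : (Fin d → ℤ) → ℝ) (k : Fin d → ℤ) :
    ENNReal.ofReal |x k| ≤ discreteMorreyNorm p q d x := by
  refine le_trans (le_of_eq ?_) (le_iSup₂ (f := fun (m : Fin d → ℤ) (N : ℕ) =>
      (((2 * N + 1) ^ d : ℕ) : ℝ≥0∞) ^ ((1:ℝ)/q - 1/p) *
      (∑ k ∈ Fintype.piFinset (fun i => Finset.Icc (m i - (N:ℤ)) (m i + (N:ℤ))),
        ENNReal.ofReal (|x k| ^ p)) ^ ((1:ℝ)/p)) k 0)
  have hk : Fintype.piFinset (fun i => ({k i} : Finset ℤ)) = {k} := Fintype.piFinset_singleton k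
  simp only [← ENNReal.ofReal_rpow_of_nonneg (abs_nonneg _) hp.le]
  simp [hk, ← ENNReal.rpow_mul, hp.ne']

/-- If `|x|` is the indicator of two points at sup-distance at least `R`, with `R` large,
then `x` is a unit vector of the discrete Morrey space. -/
theorem discreteMorreyNorm_eq_one_of_two_points {p q : ℝ} (hp : 1 ≤ p) (hpq : p < q)
    {d R : ℕ} (hR : (2 : ℝ≥0∞) ^ (1 / p) ≤ (R : ℝ≥0∞) ^ (1 / p - 1 / q))
    {a b : Fin d → ℤ} {i : Fin d} (hab : (R : ℤ) ≤ b i - a i) {x : (Fin d → ℤ) → ℝ}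
    (hx : ∀ k, |x k| ^ p = (if k = a then 1 else 0) + (if k = b then 1 else 0))
    (hxa : |x a| = 1) : discreteMorreyNorm p q d x = 1 := by
  have hp0 : 0 < p := zero_lt_one.trans_le hp
  have he : 0 < 1 / p - 1 / q := sub_pos.2 (one_div_lt_one_div_of_lt hp0 hpq)
  refine le_antisymm (iSup₂_le fun m N => ?_) ?_
  · have hsum : ∀ S : Finset (Fin d → ℤ), ∑ k ∈ S, ENNReal.ofReal (|x k| ^ p) =
        (if a ∈ S then 1 else 0) + (if b ∈ S then 1 else 0) := by
      intro S
      rw [← Finset.sum_ite_eq' S a (fun _ => (1 : ℝ≥0∞)),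
        ← Finset.sum_ite_eq' S b (fun _ => (1 : ℝ≥0∞)), ← Finset.sum_add_distrib]
      refine Finset.sum_congr rfl fun k _ => ?_
      rw [hx, ENNReal.ofReal_add (by split_ifs <;> simp) (by split_ifs <;> simp)]
      split_ifs <;> simp
    rw [hsum, ← neg_sub, ENNReal.rpow_neg, mul_comm, ← div_eq_mul_inv]
    refine ENNReal.div_le_of_le_mul ?_
    rw [one_mul]
    have hone : (1 : ℝ≥0∞) ≤ (((2 * N + 1) ^ d : ℕ) : ℝ≥0∞) ^ (1 / p - 1 / q) :=
      ENNReal.one_le_rpow (by exact_mod_cast Nat.one_le_pow _ _ (by omega)) he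
    by_cases h : a ∈ Fintype.piFinset (fun i => Finset.Icc (m i - (N:ℤ)) (m i + (N:ℤ))) ∧
        b ∈ Fintype.piFinset (fun i => Finset.Icc (m i - (N:ℤ)) (m i + (N:ℤ)))
    · rw [if_pos h.1, if_pos h.2, one_add_one_eq_two]
      refine hR.trans (ENNReal.rpow_le_rpow ?_ he.le)
      have ha := Finset.mem_Icc.1 (Fintype.mem_piFinset.1 h.1 i)
      have hb := Finset.mem_Icc.1 (Fintype.mem_piFinset.1 h.2 i)
      have hRN : R ≤ 2 * N + 1 := by omega
      exact_mod_cast hRN.trans (Nat.le_self_pow (Fin.pos i).ne' _)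
    · refine le_trans (ENNReal.rpow_le_one ?_ (by positivity)) hone
      split_ifs <;> simp_all
  · simpa [hxa] using ofReal_abs_le_discreteMorreyNorm hp0 q x a

theorem exists_natCast_rpow_ge {s : ℝ} (hs : 0 < s) {c : ℝ≥0∞} (hc : c ≠ ∞) :
    ∃ R : ℕ, 0 < R ∧ c ≤ (R : ℝ≥0∞) ^ s := by
  obtain ⟨R, hR⟩ := ENNReal.exists_nat_gt (ENNReal.rpow_ne_top_of_nonneg (inv_pos.2 hs).le hc)
  refine ⟨R, by exact_mod_cast zero_le.trans_lt hR, ?_⟩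
  simpa [← ENNReal.rpow_mul, hs.ne'] using ENNReal.rpow_le_rpow hR.le hs.le

/-- The James constant of the discrete Morrey space `ℓ^p_q(ℤ^d)` equals `2`
when `1 ≤ p < q < ∞` and `d ≥ 1`. -/
theorem james_discreteMorrey (p q : ℝ) (d : ℕ) (hp : 1 ≤ p) (hpq : p < q) (hd : 1 ≤ d) :
    (⨆ (x : (Fin d → ℤ) → ℝ) (y : (Fin d → ℤ) → ℝ)
      (_ : discreteMorreyNorm p q d x = 1) (_ : discreteMorreyNorm p q d y = 1),
      min (discreteMorreyNorm p q d (x + y)) (discreteMorreyNorm p q d (x - y))) = 2 := by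
  have hp0 : 0 < p := zero_lt_one.trans_le hp
  refine le_antisymm (iSup₂_le fun x y => iSup₂_le fun hx hy => ?_) ?_
  · refine (min_le_left _ _).trans ((discreteMorreyNorm_add_le hp q d x y).trans_eq ?_)
    rw [hx, hy, one_add_one_eq_two]
  · obtain ⟨R, hR0, hR⟩ := exists_natCast_rpow_ge
      (sub_pos.2 (one_div_lt_one_div_of_lt hp0 hpq))
      (ENNReal.rpow_ne_top_of_nonneg (one_div_pos.2 hp0).le ENNReal.ofNat_ne_top :
        (2 : ℝ≥0∞) ^ (1 / p) ≠ ∞)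
    let i : Fin d := ⟨0, hd⟩
    let b : Fin d → ℤ := fun _ => R
    have hb : b ≠ 0 := fun h => by simpa [b, hR0.ne'] using congrFun h i
    let x : (Fin d → ℤ) → ℝ := Pi.single 0 1 + Pi.single b 1
    let y : (Fin d → ℤ) → ℝ := Pi.single 0 1 - Pi.single b 1
    have hx : discreteMorreyNorm p q d x = 1 := by
      refine discreteMorreyNorm_eq_one_of_two_points (a := 0) (b := b) (i := i) hp hpq hR
        (by simp [b]) (fun k => ?_) (by simp [x, hb.symm])
      by_cases h0 : k = 0
      · simp [x, h0, hb.symm]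
      · by_cases h1 : k = b <;> simp [x, h0, h1, hb, hp0.ne']
    have hy : discreteMorreyNorm p q d y = 1 := by
      refine discreteMorreyNorm_eq_one_of_two_points (a := 0) (b := b) (i := i) hp hpq hR
        (by simp [b]) (fun k => ?_) (by simp [y, hb.symm])
      by_cases h0 : k = 0
      · simp [y, h0, hb.symm]
      · by_cases h1 : k = b <;> simp [y, h0, h1, hb, hp0.ne']
    refine le_trans (le_min ?_ ?_) (le_iSup₂_of_le x y (le_iSup₂_of_le hx hy le_rfl))
    · refine le_trans (le_of_eq ?_) (ofReal_abs_le_discreteMorreyNorm hp0 q (x + y) 0)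
      simp [x, y, hb.symm, one_add_one_eq_two]
    · refine le_trans (le_of_eq ?_) (ofReal_abs_le_discreteMorreyNorm hp0 q (x - y) b)
      simp [x, y, hb, one_add_one_eq_two]
end

section
/- Let 1 ≤ p < q < ∞ and d ≥ 1. Then the James constant of the local Morrey space LM^p_q(ℝ^d) equals 2; that is, sup{ min{‖f+g‖_{LM^p_q}, ‖f−g‖_{LM^p_q}} : f, g ∈ LM^p_q(ℝ^d), ‖f‖_{LM^p_q} = ‖g‖_{LM^p_q} = 1 } = 2. -/
open MeasureTheory
open scoped ENNReal

/-- The local Morrey norm `‖f‖_{LM^p_q}` of a (measurable) function on `ℝ^d`: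
the supremum over all balls `B = B(0,r)` centered at the origin of
`|B|^(1/q - 1/p) (∫_B |f|^p)^(1/p)`. -/
noncomputable def localMorreyNorm (p q : ℝ) (d : ℕ) (f : EuclideanSpace ℝ (Fin d) → ℝ) : ℝ≥0∞ :=
  ⨆ (r : ℝ) (_ : 0 < r),
    volume (Metric.ball (0 : EuclideanSpace ℝ (Fin d)) r) ^ ((1:ℝ)/q - 1/p) *
      (∫⁻ y in Metric.ball (0 : EuclideanSpace ℝ (Fin d)) r, ENNReal.ofReal (|f y| ^ p)) ^ ((1:ℝ)/p)

/-- The quantity `|B|^(1/q - 1/p) ‖f‖_{L^p(B)}` for the ball `B = B(0,r)`, whose supremum over `r`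
is the local Morrey norm. -/
noncomputable def localMorreyTerm (p q : ℝ) (d : ℕ) (f : EuclideanSpace ℝ (Fin d) → ℝ) (r : ℝ) :
    ℝ≥0∞ :=
  volume (Metric.ball (0 : EuclideanSpace ℝ (Fin d)) r) ^ ((1:ℝ)/q - 1/p) *
    eLpNorm f (ENNReal.ofReal p) (volume.restrict (Metric.ball 0 r))

section localMorrey

variable {p q : ℝ} {d : ℕ} {f g : EuclideanSpace ℝ (Fin d) → ℝ} {r : ℝ}

lemma localMorreyNorm_eq_iSup_term (hp : 0 < p) (f : EuclideanSpace ℝ (Fin d) → ℝ) :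
    localMorreyNorm p q d f = ⨆ (r : ℝ) (_ : 0 < r), localMorreyTerm p q d f r := by
  unfold localMorreyNorm localMorreyTerm
  refine iSup_congr fun r => iSup_congr fun _ => ?_
  rw [eLpNorm_eq_lintegral_rpow_enorm_toReal (by simpa using hp) ENNReal.ofReal_ne_top,
    ENNReal.toReal_ofReal hp.le]
  simp_rw [← ENNReal.ofReal_rpow_of_nonneg (abs_nonneg _) hp.le, Real.enorm_eq_ofReal_abs]

lemma localMorreyTerm_le_norm (hp : 0 < p) (f : EuclideanSpace ℝ (Fin d) → ℝ) (hr : 0 < r) :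
    localMorreyTerm p q d f r ≤ localMorreyNorm p q d f := by
  rw [localMorreyNorm_eq_iSup_term hp]
  exact le_iSup₂_of_le r hr le_rfl

lemma localMorreyNorm_eq_of_term_eq {c : ℝ≥0∞} (hp : 0 < p)
    (h : ∀ r, 0 < r → localMorreyTerm p q d f r = c) : localMorreyNorm p q d f = c := by
  rw [localMorreyNorm_eq_iSup_term hp]
  exact le_antisymm (iSup₂_le fun r hr => (h r hr).le) (le_iSup₂_of_le 1 one_pos (h 1 one_pos).ge)

lemma localMorreyTerm_add_le (hp : 1 ≤ p) (hf : Measurable f) (hg : Measurable g) (r : ℝ) :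
    localMorreyTerm p q d (f + g) r ≤ localMorreyTerm p q d f r + localMorreyTerm p q d g r := by
  unfold localMorreyTerm
  rw [← mul_add]
  gcongr
  exact eLpNorm_add_le hf.aestronglyMeasurable hg.aestronglyMeasurable (by simpa using hp)

lemma localMorreyTerm_const_smul (c : ℝ) (f : EuclideanSpace ℝ (Fin d) → ℝ) (r : ℝ) :
    localMorreyTerm p q d (c • f) r = ‖c‖ₑ * localMorreyTerm p q d f r := by
  unfold localMorreyTerm
  rw [eLpNorm_const_smul, mul_left_comm]

lemma localMorreyTerm_congr_abs (h : ∀ x, |f x| = |g x|) (r : ℝ) :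
    localMorreyTerm p q d f r = localMorreyTerm p q d g r := by
  unfold localMorreyTerm
  rw [eLpNorm_congr_norm_ae (g := g) (.of_forall h)]

lemma localMorreyNorm_add_le (hp : 1 ≤ p) (hf : Measurable f) (hg : Measurable g) :
    localMorreyNorm p q d (f + g) ≤ localMorreyNorm p q d f + localMorreyNorm p q d g := by
  have hp0 : 0 < p := one_pos.trans_le hp
  rw [localMorreyNorm_eq_iSup_term hp0]
  exact iSup₂_le fun r hr => (localMorreyTerm_add_le hp hf hg r).trans
    (add_le_add (localMorreyTerm_le_norm hp0 f hr) (localMorreyTerm_le_norm hp0 g hr))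

lemma volume_ball_zero_eq_rpow_mul (hr : 0 < r) :
    volume (Metric.ball (0 : EuclideanSpace ℝ (Fin d)) r) =
      ENNReal.ofReal r ^ (d : ℝ) * volume (Metric.ball (0 : EuclideanSpace ℝ (Fin d)) 1) := by
  rw [Measure.addHaar_ball_of_pos _ _ hr, finrank_euclideanSpace_fin, ENNReal.rpow_natCast,
    ENNReal.ofReal_pow hr.le]

/-- The average of a function supported in the unit ball decays as the ball grows. -/
lemma localMorreyTerm_of_support_subset_ball (hr : 1 ≤ r)
    (hf : Function.support f ⊆ Metric.ball 0 1) :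
    localMorreyTerm p q d f r =
      ENNReal.ofReal r ^ (d * (1 / q - 1 / p)) * localMorreyTerm p q d f 1 := by
  have hr0 : 0 < r := one_pos.trans_le hr
  have key : ∀ s, 1 ≤ s → eLpNorm f (ENNReal.ofReal p) (volume.restrict (Metric.ball 0 s)) =
      eLpNorm f (ENNReal.ofReal p) volume := fun s hs =>
    eLpNorm_restrict_eq_of_support_subset (hf.trans (Metric.ball_subset_ball hs))
  unfold localMorreyTerm
  rw [key r hr, key 1 le_rfl, volume_ball_zero_eq_rpow_mul hr0, ENNReal.mul_rpow_of_ne_top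
    (by simp) measure_ball_lt_top.ne, ← ENNReal.rpow_mul, mul_assoc]

lemma eLpNorm_ball_of_homogeneous {a : ℝ} (hp : 0 < p) (hr : 0 < r)
    (hf : Measurable f) (hhom : ∀ x, f (r • x) = r ^ (-a) * f x) :
    eLpNorm f (ENNReal.ofReal p) (volume.restrict (Metric.ball 0 r)) =
      ENNReal.ofReal r ^ (d / p - a) *
        eLpNorm f (ENNReal.ofReal p) (volume.restrict (Metric.ball 0 1)) := by
  have hR0 : ENNReal.ofReal r ≠ 0 := by simpa using hr
  have hRt : ENNReal.ofReal r ≠ ⊤ := ENNReal.ofReal_ne_top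
  have hmeas : Measurable fun x : EuclideanSpace ℝ (Fin d) => r • x := measurable_const_smul r
  have hpre : (fun x : EuclideanSpace ℝ (Fin d) => r • x) ⁻¹' Metric.ball 0 r =
      Metric.ball 0 1 := by
    ext x
    simp [norm_smul, abs_of_pos hr, hr]
  have hmap : Measure.map (fun x : EuclideanSpace ℝ (Fin d) => r • x)
      (volume.restrict (Metric.ball 0 1)) =
      ENNReal.ofReal r ^ (-d : ℝ) • volume.restrict (Metric.ball 0 r) := by
    rw [← hpre, ← Measure.restrict_map hmeas measurableSet_ball,
      Measure.map_addHaar_smul _ hr.ne', Measure.restrict_smul, finrank_euclideanSpace_fin,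
      abs_of_pos (by positivity), ENNReal.ofReal_inv_of_pos (by positivity),
      ENNReal.ofReal_pow hr.le, ENNReal.rpow_neg, ENNReal.rpow_natCast]
  have h1 := eLpNorm_map_measure (p := ENNReal.ofReal p) (g := f)
    (μ := volume.restrict (Metric.ball 0 1)) hf.aestronglyMeasurable hmeas.aemeasurable
  have h2 : f ∘ (fun x : EuclideanSpace ℝ (Fin d) => r • x) = (r ^ (-a)) • f := by
    ext x
    simp [hhom]
  rw [hmap, h2, eLpNorm_const_smul, eLpNorm_smul_measure_of_ne_top ENNReal.ofReal_ne_top,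
    Real.enorm_eq_ofReal (by positivity), ENNReal.toReal_div,
    ENNReal.toReal_ofReal hp.le, ENNReal.toReal_one, smul_eq_mul, ← ENNReal.rpow_mul,
    ← ENNReal.ofReal_rpow_of_pos hr] at h1
  calc _ = ENNReal.ofReal r ^ (d / p : ℝ) * (ENNReal.ofReal r ^ (-d * (1 / p) : ℝ) *
        eLpNorm f (ENNReal.ofReal p) (volume.restrict (Metric.ball 0 r))) := by
        rw [← mul_assoc, ← ENNReal.rpow_add _ _ hR0 hRt,
          show d / p + -d * (1 / p) = 0 by ring, ENNReal.rpow_zero, one_mul]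
    _ = _ := by
        rw [h1, ← mul_assoc, ← ENNReal.rpow_add _ _ hR0 hRt, ← sub_eq_add_neg]

lemma localMorreyTerm_of_homogeneous (hp : 0 < p) (hr : 0 < r)
    (hf : Measurable f) (hhom : ∀ x, f (r • x) = r ^ (-(d / q)) * f x) :
    localMorreyTerm p q d f r = localMorreyTerm p q d f 1 := by
  have hR0 : ENNReal.ofReal r ≠ 0 := by simpa using hr
  unfold localMorreyTerm
  rw [eLpNorm_ball_of_homogeneous hp hr hf hhom, volume_ball_zero_eq_rpow_mul hr,
    ENNReal.mul_rpow_of_ne_top (by simp) measure_ball_lt_top.ne, ← ENNReal.rpow_mul,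
    mul_mul_mul_comm, ← ENNReal.rpow_add _ _ hR0 ENNReal.ofReal_ne_top,
    show (d : ℝ) * (1 / q - 1 / p) + (d / p - d / q) = 0 by ring, ENNReal.rpow_zero, one_mul]

lemma eLpNorm_norm_rpow_ball_ne_top (hp : 0 < p) (hpq : p < q) (hd : 1 ≤ d) :
    eLpNorm (fun x : EuclideanSpace ℝ (Fin d) => ‖x‖ ^ (-(d / q : ℝ))) (ENNReal.ofReal p)
      (volume.restrict (Metric.ball 0 1)) ≠ ⊤ := by
  have hq : 0 < q := hp.trans hpq
  have hd0 : (0 : ℝ) < d := by exact_mod_cast hd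
  have hmeas : Measurable fun x : EuclideanSpace ℝ (Fin d) => ‖x‖ ^ (-(d / q : ℝ)) :=
    measurable_norm.pow_const _
  have hint : IntegrableOn (fun x : EuclideanSpace ℝ (Fin d) => ‖‖x‖ ^ (-(d / q : ℝ))‖ ^ p)
      (Metric.ball 0 1) volume := by
    refine integrableOn_ball_of_norm_le_rpow (C := 1) (α := d / q * p) (by simpa using hd) ?_
      (.of_forall fun x => ?_) (hmeas.norm.pow_const p).aestronglyMeasurable
    · rw [finrank_euclideanSpace_fin, div_mul_eq_mul_div, div_lt_iff₀ hq]
      gcongr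
    · rw [Real.norm_of_nonneg (by positivity), Real.norm_of_nonneg (by positivity),
        ← Real.rpow_mul (norm_nonneg x), one_mul, neg_mul]
  have h := integrable_norm_rpow_iff (p := ENNReal.ofReal p)
    (μ := volume.restrict (Metric.ball 0 1)) hmeas.aestronglyMeasurable (by simpa using hp)
    ENNReal.ofReal_ne_top
  rw [ENNReal.toReal_ofReal hp.le] at h
  exact (h.1 hint).eLpNorm_ne_top

lemma eLpNorm_norm_rpow_ball_ne_zero (hp : 0 < p) (hd : 1 ≤ d) (a : ℝ) :
    eLpNorm (fun x : EuclideanSpace ℝ (Fin d) => ‖x‖ ^ a) (ENNReal.ofReal p)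
      (volume.restrict (Metric.ball 0 1)) ≠ 0 := by
  have : Nonempty (Fin d) := ⟨⟨0, hd⟩⟩
  rw [Ne, eLpNorm_eq_zero_iff (measurable_norm.pow_const a).aestronglyMeasurable
    (by simpa using hp)]
  intro h
  have hne : ∀ᵐ x ∂volume.restrict (Metric.ball (0 : EuclideanSpace ℝ (Fin d)) 1), x ≠ 0 :=
    ae_restrict_of_ae (Measure.ae_ne volume 0)
  have hfalse : ∀ᵐ x ∂volume.restrict (Metric.ball (0 : EuclideanSpace ℝ (Fin d)) 1), False := by
    filter_upwards [h, hne] with x hx hx0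
    exact (Real.rpow_pos_of_pos (norm_pos_iff.2 hx0) a).ne' hx
  rw [Filter.eventually_false_iff_eq_bot, ae_eq_bot, Measure.restrict_eq_zero] at hfalse
  exact (Metric.measure_ball_pos volume _ one_pos).ne' hfalse

/-- A multiple of `‖x‖ ^ (-d/q)` attains its local Morrey norm `1` on every centered ball. -/
lemma exists_localMorreyTerm_eq_one (hp : 0 < p) (hpq : p < q) (hd : 1 ≤ d) :
    ∃ f : EuclideanSpace ℝ (Fin d) → ℝ, Measurable f ∧
      ∀ r, 0 < r → localMorreyTerm p q d f r = 1 := by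
  set u : EuclideanSpace ℝ (Fin d) → ℝ := fun x => ‖x‖ ^ (-(d / q : ℝ)) with hu
  have hmeas : Measurable u := measurable_norm.pow_const _
  have hball0 : volume (Metric.ball (0 : EuclideanSpace ℝ (Fin d)) 1) ≠ 0 :=
    (Metric.measure_ball_pos volume _ one_pos).ne'
  have h0 : localMorreyTerm p q d u 1 ≠ 0 :=
    mul_ne_zero (ENNReal.rpow_pos hball0.bot_lt measure_ball_lt_top.ne).ne'
      (eLpNorm_norm_rpow_ball_ne_zero hp hd _)
  have ht : localMorreyTerm p q d u 1 ≠ ⊤ :=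
    ENNReal.mul_ne_top (ENNReal.rpow_ne_top_of_ne_zero hball0 measure_ball_lt_top.ne)
      (eLpNorm_norm_rpow_ball_ne_top hp hpq hd)
  refine ⟨(localMorreyTerm p q d u 1)⁻¹.toReal • u, hmeas.const_smul _, fun r hr => ?_⟩
  rw [localMorreyTerm_const_smul, Real.enorm_eq_ofReal ENNReal.toReal_nonneg,
    ENNReal.ofReal_toReal (ENNReal.inv_ne_top.2 h0), localMorreyTerm_of_homogeneous hp hr hmeas,
    ENNReal.inv_mul_cancel h0 ht]
  intro x
  simp only [hu, norm_smul, Real.norm_of_nonneg hr.le]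
  exact Real.mul_rpow hr.le (norm_nonneg x)

end localMorrey

/-- The James constant of the local Morrey space `LM^p_q(ℝ^d)` equals `2`
when `1 ≤ p < q < ∞` and `d ≥ 1`. -/
theorem james_localMorrey (p q : ℝ) (d : ℕ) (hp : 1 ≤ p) (hpq : p < q) (hd : 1 ≤ d) :
    (⨆ (f : EuclideanSpace ℝ (Fin d) → ℝ) (g : EuclideanSpace ℝ (Fin d) → ℝ)
      (_ : Measurable f) (_ : Measurable g)
      (_ : localMorreyNorm p q d f = 1) (_ : localMorreyNorm p q d g = 1),
      min (localMorreyNorm p q d (f + g)) (localMorreyNorm p q d (f - g))) = 2 := by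
  have hp0 : 0 < p := one_pos.trans_le hp
  refine le_antisymm ?_ ?_
  · refine iSup_le fun f => iSup_le fun g => iSup_le fun hf => iSup_le fun hg => iSup_le fun hf1 =>
      iSup_le fun hg1 => (min_le_left _ _).trans ?_
    calc _ ≤ _ := localMorreyNorm_add_le hp hf hg
      _ = 2 := by rw [hf1, hg1, one_add_one_eq_two]
  · obtain ⟨f, hf, hf1⟩ := exists_localMorreyTerm_eq_one hp0 hpq hd
    classical
    set g : EuclideanSpace ℝ (Fin d) → ℝ := (Metric.ball 0 1).piecewise f (-f) with hg_def
    have hg : Measurable g := hf.piecewise measurableSet_ball hf.neg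
    have hg1 : ∀ r, 0 < r → localMorreyTerm p q d g r = 1 := fun r hr => by
      rw [← hf1 r hr]
      refine localMorreyTerm_congr_abs (fun x => ?_) r
      by_cases hx : x ∈ Metric.ball 0 1 <;> simp [hg_def, hx]
    have htwo : ∀ r, 0 < r → localMorreyTerm p q d ((2 : ℝ) • f) r = 2 := fun r hr => by
      rw [localMorreyTerm_const_smul, hf1 r hr, mul_one, Real.enorm_eq_ofReal zero_le_two,
        ENNReal.ofReal_ofNat]
    have hsum : (f + g) + (f - g) = (2 : ℝ) • f := by
      rw [two_smul]; abel
    have hadd1 : localMorreyTerm p q d (f + g) 1 = 2 := by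
      rw [← htwo 1 one_pos]
      unfold localMorreyTerm
      congr 1
      refine eLpNorm_congr_ae ?_
      filter_upwards [ae_restrict_mem measurableSet_ball] with x hx
      rw [Pi.add_apply, hg_def, Set.piecewise_eq_of_mem _ _ _ hx, Pi.smul_apply, two_smul]
    have hsupp : Function.support (f + g) ⊆ Metric.ball 0 1 := by
      intro x hx
      by_contra hx'
      exact hx (by simp only [Pi.add_apply, hg_def, Set.piecewise_eq_of_notMem _ _ _ hx',
        Pi.neg_apply, add_neg_cancel])
    have hadd : 2 ≤ localMorreyNorm p q d (f + g) :=
      hadd1.ge.trans (localMorreyTerm_le_norm hp0 _ one_pos)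
    have hsub : 2 ≤ localMorreyNorm p q d (f - g) := by
      have hexp : 0 < -((d : ℝ) * (1 / q - 1 / p)) := by
        have hd0 : (0 : ℝ) < d := by exact_mod_cast hd
        have := one_div_lt_one_div_of_lt hp0 hpq
        nlinarith
      have hlim : Filter.Tendsto (fun r : ℝ => ENNReal.ofReal r ^ ((d : ℝ) * (1 / q - 1 / p)) * 2 +
          localMorreyNorm p q d (f - g)) Filter.atTop
          (nhds (0 * 2 + localMorreyNorm p q d (f - g))) := by
        refine (ENNReal.Tendsto.mul_const ?_ (.inr ENNReal.ofNat_ne_top)).add_const _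
        have h := (ENNReal.continuous_rpow_const (y := (d : ℝ) * (1 / q - 1 / p))).tendsto ⊤
        rw [ENNReal.top_rpow_of_neg (neg_pos.1 hexp)] at h
        exact h.comp ENNReal.tendsto_ofReal_atTop
      rw [zero_mul, zero_add] at hlim
      refine ge_of_tendsto hlim ?_
      filter_upwards [Filter.eventually_ge_atTop (1 : ℝ)] with r hr
      have hr0 : 0 < r := one_pos.trans_le hr
      calc (2 : ℝ≥0∞) = localMorreyTerm p q d ((f + g) + (f - g)) r := by rw [hsum, htwo r hr0]
        _ ≤ _ := localMorreyTerm_add_le hp (hf.add hg) (hf.sub hg) r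
        _ ≤ _ := by
          rw [localMorreyTerm_of_support_subset_ball hr hsupp, hadd1]
          gcongr
          exact localMorreyTerm_le_norm hp0 _ hr0
    refine (le_min hadd hsub).trans ?_
    refine le_iSup_of_le f <| le_iSup_of_le g <| le_iSup_of_le hf <| le_iSup_of_le hg <| ?_
    exact le_iSup_of_le (localMorreyNorm_eq_of_term_eq hp0 hf1) <|
      le_iSup_of_le (localMorreyNorm_eq_of_term_eq hp0 hg1) le_rfl
end
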